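/- For t > 0 and x > 0, define p_t(x,y) = (1/π)·t/(t² + (x−y)²) − (1/(x·y))·∫₀^t f(s/x)·f((t−s)/y)/(s/x + (t−s)/y) ds for y > 0. Then ∫₀^∞ p_t(x,y) dy = 1 − ∫₀^t f(s/x)/s ds. (Consequently the first-exit-time distribution of the Cauchy process from (0,∞) started at x has density t ↦ (1/t)·f(t/x) = (1/π)·(x/(t²+x²))·e^{η(t/x)}.) -/

import Mathlib

open Real MeasureTheory Set

/-- `η t = (1/4)·log(1+t²) − (1/π)·∫₀^t log|s|/(1+s²) ds`. -/
noncomputable def etaF (t : ℝ) : ℝ :=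
  Real.log (1 + t ^ 2) / 4 - (1 / Real.pi) * ∫ s in (0 : ℝ)..t, Real.log |s| / (1 + s ^ 2)

/-- The first-exit-time density profile `f(s) = (1/π)·(s/(1+s²))·e^{η(s)}`. -/
noncomputable def fexit (s : ℝ) : ℝ :=
  (1 / Real.pi) * (s / (1 + s ^ 2)) * Real.exp (etaF s)

/-- The transition density of the Cauchy process killed on exiting `(0,∞)`. -/
noncomputable def pD (t x y : ℝ) : ℝ :=
  (1 / Real.pi) * (t / (t ^ 2 + (x - y) ^ 2))
    - (1 / (x * y)) * ∫ s in (0 : ℝ)..t,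
        fexit (s / x) * fexit ((t - s) / y) / (s / x + (t - s) / y)


/-- The strip `-π/2 < Im w < 3π/2`. -/
def logStrip : Set ℂ := {w | -(π / 2) < w.im ∧ w.im < 3 * π / 2}

theorem isOpen_logStrip : IsOpen logStrip :=
  (isOpen_lt continuous_const Complex.continuous_im).inter
    (isOpen_lt Complex.continuous_im continuous_const)

theorem convex_logStrip : Convex ℝ logStrip :=
  (convex_halfSpace_im_gt _).inter (convex_halfSpace_im_lt _)

theorem mem_logStrip {x y : ℝ} (hy : y ∈ Icc 0 π) : (x + y * Complex.I : ℂ) ∈ logStrip := by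
  have := Real.pi_pos
  constructor <;> simp <;> linarith [hy.1, hy.2]

theorem ofReal_mem_logStrip (x : ℝ) : (x : ℂ) ∈ logStrip := by
  simpa using mem_logStrip (x := x) (y := 0) ⟨le_rfl, Real.pi_pos.le⟩

/-- A quotient with a simple zero of the denominator cancelled by a zero of the numerator. -/
theorem exists_differentiableOn_quotient {U : Set ℂ} (hU : IsOpen U) {N D : ℂ → ℂ} {a : ℂ}
    (ha : a ∈ U) (hN : DifferentiableOn ℂ N U) (hD : DifferentiableOn ℂ D U) (hNa : N a = 0)
    (hDa : D a = 0) (hDa' : deriv D a ≠ 0) (hne : ∀ z ∈ U, D z = 0 → z = a) :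
    ∃ q : ℂ → ℂ, DifferentiableOn ℂ q U ∧ ∀ z ∈ U, q z * D z = N z := by
  have key : ∀ z ∈ U, dslope D a z ≠ 0 := by
    intro z hz h
    have h1 := sub_smul_dslope D a z
    rw [h, hDa] at h1
    have : z = a := hne z hz (by simpa using h1.symm)
    subst this
    exact hDa' (by simpa using h)
  refine ⟨fun z => dslope N a z / dslope D a z, ?_, ?_⟩
  · exact ((Complex.differentiableOn_dslope (hU.mem_nhds ha)).2 hN).div
      ((Complex.differentiableOn_dslope (hU.mem_nhds ha)).2 hD) key
  · intro z hz
    have h1 := sub_smul_dslope D a z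
    have h2 := sub_smul_dslope N a z
    rw [hDa, sub_zero, smul_eq_mul] at h1
    rw [hNa, sub_zero, smul_eq_mul] at h2
    rw [← h1, ← h2]
    field_simp [key z hz]

theorem eq_of_exp_add_exp_neg_eq_zero {w : ℂ} (hw : w ∈ logStrip)
    (h : Complex.exp w + Complex.exp (-w) = 0) : w = π / 2 * Complex.I := by
  have h1 : Complex.exp w = Complex.exp (-w + π * Complex.I) := by
    rw [Complex.exp_add, Complex.exp_pi_mul_I]; linear_combination h
  obtain ⟨n, hn⟩ := Complex.exp_eq_exp_iff_exists_int.1 h1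
  have him := congrArg Complex.im hn
  simp at him
  obtain ⟨hw1, hw2⟩ := hw
  have hn1 : (n : ℝ) < 1 := by
    by_contra hc
    push Not at hc
    nlinarith
  have hn2 : (-1 : ℝ) < n := by
    by_contra hc
    push Not at hc
    nlinarith
  have : n = 0 := by
    have a1 : n < 1 := by exact_mod_cast hn1
    have a2 : -1 < n := by exact_mod_cast hn2
    omega
  subst this
  push_cast at hn
  linear_combination hn / 2

theorem eq_of_exp_eq_exp_ofReal {w : ℂ} (hw : w ∈ logStrip) {c : ℝ}
    (h : Complex.exp w = Complex.exp c) : w = c := by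
  obtain ⟨n, hn⟩ := Complex.exp_eq_exp_iff_exists_int.1 h
  have him := congrArg Complex.im hn
  simp at him
  obtain ⟨hw1, hw2⟩ := hw
  have hn1 : (n : ℝ) < 1 := by
    by_contra hc
    push Not at hc
    nlinarith
  have hn2 : (-1 : ℝ) < n := by
    by_contra hc
    push Not at hc
    nlinarith
  have : n = 0 := by
    have a1 : n < 1 := by exact_mod_cast hn1
    have a2 : -1 < n := by exact_mod_cast hn2
    omega
  subst this
  simpa using hn

theorem intervalIntegrable_log_abs_div (a b : ℝ) :
    IntervalIntegrable (fun s : ℝ => Real.log |s| / (1 + s ^ 2)) volume a b := by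
  have h : IntervalIntegrable (fun s : ℝ => Real.log s) volume a b :=
    intervalIntegral.intervalIntegrable_log'
  have hc : ContinuousOn (fun s : ℝ => (1 + s ^ 2)⁻¹) (uIcc a b) := by
    apply Continuous.continuousOn
    exact Continuous.inv₀ (by fun_prop) (fun s => by positivity)
  simpa [Real.log_abs, div_eq_mul_inv] using h.mul_continuousOn hc

theorem continuous_etaF : Continuous etaF := by
  have h := intervalIntegral.continuous_primitive intervalIntegrable_log_abs_div 0
  have h2 : Continuous fun t : ℝ => Real.log (1 + t ^ 2) / 4 :=
    (Continuous.log (by fun_prop) (fun s => by positivity)).div_const 4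
  exact h2.sub (h.const_mul _)

theorem etaF_zero : etaF 0 = 0 := by simp [etaF]

theorem hasDerivAt_etaF {t : ℝ} (ht : 0 < t) :
    HasDerivAt etaF ((t / 2 - Real.log t / π) / (1 + t ^ 2)) t := by
  have hc : ContinuousOn (fun s : ℝ => Real.log |s| / (1 + s ^ 2)) (Ioi 0) := by
    refine ContinuousOn.div (ContinuousOn.log (by fun_prop) fun s hs => ?_) (by fun_prop)
      fun s _ => by positivity
    simpa using (ne_of_gt hs)
  have h1 : HasDerivAt (fun u => ∫ s in (0 : ℝ)..u, Real.log |s| / (1 + s ^ 2))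
      (Real.log |t| / (1 + t ^ 2)) t :=
    intervalIntegral.integral_hasDerivAt_right (intervalIntegrable_log_abs_div 0 t)
      (hc.stronglyMeasurableAtFilter isOpen_Ioi t ht) (hc.continuousAt (Ioi_mem_nhds ht))
  have h2 : HasDerivAt (fun t : ℝ => Real.log (1 + t ^ 2) / 4) ((2 * t / (1 + t ^ 2)) / 4) t := by
    have : HasDerivAt (fun t : ℝ => 1 + t ^ 2) (2 * t) t := by
      simpa using (hasDerivAt_pow 2 t).const_add 1
    exact (this.log (by positivity)).div_const 4
  refine (h2.sub (h1.const_mul (1 / π))).congr_deriv ?_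
  rw [abs_of_pos ht]
  field_simp
  ring

theorem continuous_fexit : Continuous fexit := by
  have h : Continuous fun s : ℝ => s / (1 + s ^ 2) :=
    continuous_id.div (by fun_prop) fun s => by positivity
  exact (h.const_mul _).mul (Real.continuous_exp.comp continuous_etaF)

theorem fexit_nonneg {s : ℝ} (hs : 0 ≤ s) : 0 ≤ fexit s := by
  rw [fexit]
  positivity

theorem log_div_pi_le {t : ℝ} (ht : 0 < t) : Real.log t / π ≤ t / 2 := by
  have h1 := Real.log_le_sub_one_of_pos ht
  have h2 := Real.pi_gt_three
  rw [div_le_div_iff₀ Real.pi_pos two_pos]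
  nlinarith

theorem etaF_nonneg {t : ℝ} (ht : 0 ≤ t) : 0 ≤ etaF t := by
  have : MonotoneOn etaF (Ici 0) := by
    apply monotoneOn_of_deriv_nonneg (convex_Ici 0) continuous_etaF.continuousOn
    · rw [interior_Ici]
      exact fun s hs => (hasDerivAt_etaF hs).differentiableAt.differentiableWithinAt
    · rw [interior_Ici]
      intro s hs
      rw [(hasDerivAt_etaF hs).deriv]
      exact div_nonneg (sub_nonneg.2 (log_div_pi_le hs)) (by positivity)
  simpa [etaF_zero] using this (mem_Ici.2 le_rfl) ht ht

theorem hasDerivAt_etaF_exp (x : ℝ) :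
    HasDerivAt (fun x => etaF (Real.exp x))
      ((Real.exp x / 2 - x / π) / (Real.exp x + Real.exp (-x))) x := by
  refine ((hasDerivAt_etaF (Real.exp_pos x)).comp x (Real.hasDerivAt_exp x)).congr_deriv ?_
  rw [Real.log_exp, Real.exp_neg]
  field_simp
  ring

/-- The holomorphic extension `w ↦ η(e^w)` to the strip. -/
theorem exists_holomorphic_etaF_exp : ∃ θ k : ℂ → ℂ,
    (∀ w ∈ logStrip, HasDerivAt θ (k w) w) ∧
    (∀ w ∈ logStrip, k w * (Complex.exp w + Complex.exp (-w)) = Complex.exp w / 2 - w / π) ∧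
    ∀ x : ℝ, θ x = etaF (Real.exp x) := by
  have hpi := Real.pi_pos
  have hD : ∀ w : ℂ, HasDerivAt (fun w => Complex.exp w + Complex.exp (-w))
      (Complex.exp w - Complex.exp (-w)) w := by
    intro w
    refine ((Complex.hasDerivAt_exp w).add (hasDerivAt_neg w).cexp).congr_deriv ?_
    ring
  have e1 : Complex.exp (π / 2 * Complex.I) = Complex.I := Complex.exp_pi_div_two_mul_I
  have e2 : Complex.exp (-(π / 2 * Complex.I)) = -Complex.I := by
    rw [Complex.exp_neg, e1, Complex.inv_I]
  obtain ⟨k, hk, hkeq⟩ := exists_differentiableOn_quotient isOpen_logStrip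
    (N := fun w => Complex.exp w / 2 - w / π) (D := fun w => Complex.exp w + Complex.exp (-w))
    (a := π / 2 * Complex.I) (by
      have := mem_logStrip (x := 0) (y := π / 2) ⟨by positivity, by linarith⟩
      simpa using this)
    (by fun_prop) (by fun_prop) (by simp only [e1]; field_simp; ring) (by simp [e1, e2])
    (by rw [(hD _).deriv, e1, e2]; simp [← two_mul])
    (fun z hz h => eq_of_exp_add_exp_neg_eq_zero hz h)
  obtain ⟨g, hg⟩ := convex_logStrip.exists_forall_hasDerivWithinAt hk
  have hg' : ∀ w ∈ logStrip, HasDerivAt g (k w) w :=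
    fun w hw => (hg w hw).hasDerivAt (isOpen_logStrip.mem_nhds hw)
  refine ⟨fun w => g w - g 0 + etaF 1, k, fun w hw => ((hg' w hw).sub_const _).add_const _,
    hkeq, ?_⟩
  have hreal : ∀ x : ℝ, HasDerivAt (fun x : ℝ => g x - etaF (Real.exp x)) 0 x := by
    intro x
    refine ((hg' x (ofReal_mem_logStrip x)).comp_ofReal.sub
      (hasDerivAt_etaF_exp x).ofReal_comp).congr_deriv ?_
    have h := hkeq x (ofReal_mem_logStrip x)
    have hpos : Real.exp x + Real.exp (-x) ≠ 0 := by positivity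
    have hpos' : Complex.exp x + Complex.exp (-x) ≠ 0 := by exact_mod_cast hpos
    push_cast
    rw [← h]
    field_simp
    ring
  intro x
  have := is_const_of_deriv_eq_zero (fun x => (hreal x).differentiableAt)
    (fun x => (hreal x).deriv) x 0
  simp at this
  linear_combination this

/-- Bound for the vertical variation of the extension of `x ↦ η(e^x)` to the strip. -/
noncomputable def verticalBound (x : ℝ) : ℝ :=
  2 * Real.exp (-|x|) * (Real.exp x / 2 + |x| / π + 1)

theorem verticalBound_le {x : ℝ} (hx : 0 ≤ x) : verticalBound x ≤ 3 := by
  have h1 : |x| / π ≤ x := by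
    rw [abs_of_nonneg hx, div_le_iff₀ Real.pi_pos]
    nlinarith [Real.pi_gt_three]
  have h2 := Real.add_one_le_exp x
  have h3 : Real.exp (-x) * Real.exp x = 1 := by rw [← Real.exp_add]; simp
  rw [verticalBound]
  calc _ ≤ 2 * Real.exp (-|x|) * (Real.exp x / 2 + Real.exp x) := by
        gcongr 2 * Real.exp (-|x|) * ?_
        linarith
    _ = 3 * (Real.exp (-x) * Real.exp x) := by rw [abs_of_nonneg hx]; ring
    _ = 3 := by rw [h3, mul_one]

theorem tendsto_verticalBound_atBot : Filter.Tendsto verticalBound Filter.atBot (nhds 0) := by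
  have h0 : Filter.Tendsto (fun u : ℝ => Real.exp (-u)) Filter.atTop (nhds 0) :=
    Real.tendsto_exp_neg_atTop_nhds_zero
  have h1 : Filter.Tendsto (fun u : ℝ => u * Real.exp (-u)) Filter.atTop (nhds 0) := by
    simpa using Real.tendsto_pow_mul_exp_neg_atTop_nhds_zero 1
  have h2 : Filter.Tendsto (fun u : ℝ => Real.exp (-u) * Real.exp (-u)
      + 2 / π * (u * Real.exp (-u)) + 2 * Real.exp (-u)) Filter.atTop (nhds 0) := by
    simpa using ((h0.mul h0).add (h1.const_mul (2 / π))).add (h0.const_mul 2)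
  refine (h2.comp Filter.tendsto_neg_atBot_atTop).congr' ?_
  filter_upwards [Filter.eventually_le_atBot (0 : ℝ)] with x hx
  simp only [Function.comp, verticalBound, abs_of_nonpos hx, neg_neg]
  ring

theorem norm_exp_add_exp_neg_ge {w : ℂ} (hw : 1 ≤ |w.re|) :
    Real.exp |w.re| / 2 ≤ ‖Complex.exp w + Complex.exp (-w)‖ := by
  have key : Real.exp |w.re| / 2 ≤ Real.exp |w.re| - Real.exp (-|w.re|) := by
    have h2 := Real.add_one_le_exp |w.re|
    have h3 : Real.exp (-|w.re|) ≤ 1 := Real.exp_le_one_iff.2 (by linarith)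
    linarith
  refine key.trans ?_
  rcases le_total 0 w.re with h | h
  · have := norm_sub_le_norm_add (Complex.exp w) (Complex.exp (-w))
    simpa [Complex.norm_exp, abs_of_nonneg h] using this
  · have := norm_sub_le_norm_add (Complex.exp (-w)) (Complex.exp w)
    rw [add_comm (Complex.exp w)]
    simpa [Complex.norm_exp, abs_of_nonpos h] using this

theorem norm_sub_le_verticalBound {θ k : ℂ → ℂ} (hθ : ∀ w ∈ logStrip, HasDerivAt θ (k w) w)
    (hk : ∀ w ∈ logStrip, k w * (Complex.exp w + Complex.exp (-w)) = Complex.exp w / 2 - w / π)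
    {x y : ℝ} (hx : 1 ≤ |x|) (hy : y ∈ Icc 0 π) :
    ‖θ (x + y * Complex.I) - θ x‖ ≤ verticalBound x * π := by
  have hpi := Real.pi_pos
  have hder : ∀ v ∈ Icc (0 : ℝ) π, HasDerivWithinAt (fun v : ℝ => θ (x + v * Complex.I))
      (k (x + v * Complex.I) * Complex.I) (Icc 0 π) v := by
    intro v hv
    have h1 : HasDerivAt (fun v : ℝ => (x + v * Complex.I : ℂ)) Complex.I v := by
      simpa using ((hasDerivAt_id v).ofReal_comp.mul_const Complex.I).const_add (x : ℂ)
    exact ((hθ _ (mem_logStrip hv)).comp v h1).hasDerivWithinAt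
  have hbd : ∀ v ∈ Icc (0 : ℝ) π, ‖k (x + v * Complex.I) * Complex.I‖ ≤ verticalBound x := by
    intro v hv
    set w : ℂ := x + v * Complex.I with hw
    have hre : w.re = x := by simp [hw]
    have h1 := norm_exp_add_exp_neg_ge (w := w) (by rwa [hre])
    rw [hre] at h1
    have h2 : ‖k w‖ * ‖Complex.exp w + Complex.exp (-w)‖ ≤ Real.exp x / 2 + |x| / π + 1 := by
      rw [← norm_mul, hk w (mem_logStrip hv)]
      refine (norm_sub_le _ _).trans ?_
      have h3 : ‖w‖ ≤ |x| + π := by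
        refine (norm_add_le _ _).trans ?_
        simp [abs_of_nonneg hv.1, hv.2]
      have h4 : ‖w / π‖ ≤ |x| / π + 1 := by
        rw [norm_div, Complex.norm_real, Real.norm_of_nonneg hpi.le, div_le_iff₀ hpi]
        field_simp
        linarith
      have h5 : ‖Complex.exp w / 2‖ = Real.exp x / 2 := by
        rw [norm_div, Complex.norm_exp, hre]; norm_num
      linarith
    have h6 : ‖k w‖ * (Real.exp |x| / 2) ≤ Real.exp x / 2 + |x| / π + 1 :=
      (mul_le_mul_of_nonneg_left h1 (norm_nonneg _)).trans h2
    rw [norm_mul, Complex.norm_I, mul_one, verticalBound, Real.exp_neg]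
    calc ‖k w‖ = 2 * (Real.exp |x|)⁻¹ * (‖k w‖ * (Real.exp |x| / 2)) := by field_simp
      _ ≤ _ := by gcongr
  have := (convex_Icc (0 : ℝ) π).norm_image_sub_le_of_norm_hasDerivWithin_le hder hbd
    (left_mem_Icc.2 hpi.le) hy
  simp only [Complex.ofReal_zero, zero_mul, add_zero, sub_zero, Real.norm_of_nonneg hy.1] at this
  refine this.trans (mul_le_mul_of_nonneg_left hy.2 ?_)
  rw [verticalBound]
  positivity

theorem extension_top_boundary {θ k : ℂ → ℂ} (hθ : ∀ w ∈ logStrip, HasDerivAt θ (k w) w)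
    (hk : ∀ w ∈ logStrip, k w * (Complex.exp w + Complex.exp (-w)) = Complex.exp w / 2 - w / π)
    (hreal : ∀ x : ℝ, θ x = etaF (Real.exp x)) (x : ℝ) :
    θ (x + π * Complex.I) = ((Real.log (1 + Real.exp x ^ 2) / 2 - etaF (Real.exp x) : ℝ) : ℂ)
      + (Real.arctan (Real.exp x) : ℝ) * Complex.I := by
  have hpi := Real.pi_pos
  have hmem : π ∈ Icc 0 π := right_mem_Icc.2 hpi.le
  set H : ℝ → ℂ := fun x => θ (x + π * Complex.I)
    - (((Real.log (1 + Real.exp x ^ 2) / 2 - etaF (Real.exp x) : ℝ) : ℂ)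
      + (Real.arctan (Real.exp x) : ℝ) * Complex.I) with hH
  have hder : ∀ x : ℝ, HasDerivAt H 0 x := by
    intro x
    have hlog : HasDerivAt (fun x : ℝ => Real.log (1 + Real.exp x ^ 2) / 2)
        ((2 * Real.exp x * Real.exp x) / (1 + Real.exp x ^ 2) / 2) x := by
      have : HasDerivAt (fun x : ℝ => 1 + Real.exp x ^ 2) (2 * Real.exp x * Real.exp x) x := by
        simpa using ((Real.hasDerivAt_exp x).pow 2).const_add 1
      exact (this.log (by positivity)).div_const 2
    have harc := (Real.hasDerivAt_exp x).arctan
    have h1 : HasDerivAt (fun x : ℝ => θ (x + π * Complex.I)) (k (x + π * Complex.I)) x := by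
      have := (hθ _ (mem_logStrip (x := x) hmem)).comp_add_const (x : ℂ) (π * Complex.I)
      exact this.comp_ofReal
    refine (h1.sub (((hlog.sub (hasDerivAt_etaF_exp x)).ofReal_comp).add
      (harc.ofReal_comp.mul_const Complex.I))).congr_deriv ?_
    have h2 := hk _ (mem_logStrip (x := x) hmem)
    rw [neg_add, Complex.exp_add, Complex.exp_add, Complex.exp_neg (π * Complex.I),
      Complex.exp_pi_mul_I, Complex.exp_neg] at h2
    rw [Real.exp_neg]
    push_cast
    have hE2 : (1 + Complex.exp x ^ 2) ≠ 0 := by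
      have : (1 + Real.exp x ^ 2) ≠ 0 := by positivity
      exact_mod_cast this
    have hE3 : Complex.exp x + (Complex.exp x)⁻¹ = (1 + Complex.exp x ^ 2) / Complex.exp x := by
      field_simp; ring
    have h3 : k (x + π * Complex.I) = (Complex.exp x / 2 + (x + π * Complex.I) / π)
        * Complex.exp x / (1 + Complex.exp x ^ 2) := by
      rw [eq_div_iff hE2]
      have h4 : k (x + π * Complex.I) * (Complex.exp x + (Complex.exp x)⁻¹)
          = Complex.exp x / 2 + (x + π * Complex.I) / π := by
        rw [inv_neg, inv_one] at h2
        linear_combination -h2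
      rw [← h4, hE3]
      field_simp
    rw [h3, hE3]
    field_simp
    ring
  have hconst : ∀ y, H y = H x :=
    fun y => is_const_of_deriv_eq_zero (fun x => (hder x).differentiableAt)
      (fun x => (hder x).deriv) y x
  have hlim : Filter.Tendsto H Filter.atBot (nhds 0) := by
    have hexp := Real.tendsto_exp_atBot
    have a1 : Filter.Tendsto (fun x : ℝ => θ (x + π * Complex.I) - θ x) Filter.atBot (nhds 0) := by
      refine squeeze_zero_norm' ?_ (by simpa using tendsto_verticalBound_atBot.mul_const π)
      filter_upwards [Filter.eventually_le_atBot (-1 : ℝ)] with y hy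
      exact norm_sub_le_verticalBound hθ hk (by rw [abs_of_nonpos] <;> linarith) hmem
    have a2 : Filter.Tendsto (fun x : ℝ => (etaF (Real.exp x) : ℂ)) Filter.atBot (nhds 0) := by
      have := (Complex.continuous_ofReal.comp continuous_etaF).tendsto 0
      simpa [Function.comp_def, etaF_zero] using this.comp hexp
    have a3 : Filter.Tendsto (fun x : ℝ =>
        (((Real.log (1 + Real.exp x ^ 2) / 2 - etaF (Real.exp x) : ℝ) : ℂ)
          + (Real.arctan (Real.exp x) : ℝ) * Complex.I)) Filter.atBot (nhds 0) := by
      have hc : Continuous fun s : ℝ => (((Real.log (1 + s ^ 2) / 2 - etaF s : ℝ) : ℂ)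
          + (Real.arctan s : ℝ) * Complex.I) := by
        have h1 : Continuous fun s : ℝ => Real.log (1 + s ^ 2) / 2 :=
          (Continuous.log (by fun_prop) (fun s => by positivity)).div_const 2
        exact (Complex.continuous_ofReal.comp (h1.sub continuous_etaF)).add
          ((Complex.continuous_ofReal.comp Real.continuous_arctan).mul_const _)
      have := hc.tendsto 0
      simpa [Function.comp_def, etaF_zero] using this.comp hexp
    have := (a1.add a2).sub a3
    simp only [hreal, sub_add_cancel] at this
    simpa [hH] using this
  have h0 : H x = 0 :=
    tendsto_nhds_unique (tendsto_const_nhds.congr fun y => (hconst y).symm) hlim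
  exact sub_eq_zero.1 h0

theorem im_exp_neg_extension_top {θ k : ℂ → ℂ} (hθ : ∀ w ∈ logStrip, HasDerivAt θ (k w) w)
    (hk : ∀ w ∈ logStrip, k w * (Complex.exp w + Complex.exp (-w)) = Complex.exp w / 2 - w / π)
    (hreal : ∀ x : ℝ, θ x = etaF (Real.exp x)) (x : ℝ) :
    (Complex.exp (-θ (x + π * Complex.I))).im = -(π * fexit (Real.exp x)) := by
  rw [extension_top_boundary hθ hk hreal, Complex.exp_im, fexit]
  have hre : ∀ a b : ℝ, (-((a : ℂ) + b * Complex.I)).re = -a := by intro a b; simp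
  have him : ∀ a b : ℝ, (-((a : ℂ) + b * Complex.I)).im = -b := by intro a b; simp
  rw [hre, him, Real.sin_neg, Real.sin_arctan]
  set s := Real.exp x
  have hs : 0 < 1 + s ^ 2 := by positivity
  have hsq : Real.exp (Real.log (1 + s ^ 2) / 2) = √(1 + s ^ 2) := by
    rw [← Real.log_sqrt hs.le, Real.exp_log (Real.sqrt_pos.2 hs)]
  rw [show -(Real.log (1 + s ^ 2) / 2 - etaF s) = etaF s - Real.log (1 + s ^ 2) / 2 by ring,
    Real.exp_sub, hsq]
  have h2 : √(1 + s ^ 2) ^ 2 = 1 + s ^ 2 := Real.sq_sqrt hs.le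
  field_simp
  rw [h2]

theorem tendsto_integral_vertical {Q : ℂ → ℂ} (hQ : ContinuousOn Q logStrip) {l : Filter ℝ}
    [l.IsCountablyGenerated] {L : ℂ} {M : ℝ}
    (hbd : ∀ᶠ x : ℝ in l, ∀ y ∈ Icc 0 π, ‖Q (x + y * Complex.I)‖ ≤ M)
    (hlim : ∀ y ∈ Icc 0 π, Filter.Tendsto (fun x : ℝ => Q (x + y * Complex.I)) l (nhds L)) :
    Filter.Tendsto (fun x : ℝ => ∫ y in (0 : ℝ)..π, Q (x + y * Complex.I)) l (nhds (π * L)) := by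
  have hpi := Real.pi_pos
  have hsub : uIoc 0 π ⊆ Icc 0 π := by
    rw [uIoc_of_le hpi.le]; exact Ioc_subset_Icc_self
  have := intervalIntegral.tendsto_integral_filter_of_dominated_convergence
    (μ := volume) (a := 0) (b := π) (l := l) (F := fun (x : ℝ) (y : ℝ) => Q (x + y * Complex.I))
    (f := fun _ => L) (fun _ => M) ?_ ?_ intervalIntegrable_const ?_
  · simpa using this
  · refine Filter.Eventually.of_forall fun x => ?_
    refine ContinuousOn.aestronglyMeasurable ?_ measurableSet_uIoc
    exact hQ.comp (by fun_prop) fun y hy => mem_logStrip (hsub hy)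
  · filter_upwards [hbd] with x hx
    exact Filter.Eventually.of_forall fun y hy => hx y (hsub hy)
  · exact Filter.Eventually.of_forall fun y hy => hlim y (hsub hy)

theorem norm_exp_neg_extension_le {θ k : ℂ → ℂ} (hθ : ∀ w ∈ logStrip, HasDerivAt θ (k w) w)
    (hk : ∀ w ∈ logStrip, k w * (Complex.exp w + Complex.exp (-w)) = Complex.exp w / 2 - w / π)
    (hreal : ∀ x : ℝ, θ x = etaF (Real.exp x)) {x y : ℝ} (hx : 1 ≤ |x|) (hy : y ∈ Icc 0 π)
    (hb : verticalBound x ≤ 3) :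
    ‖Complex.exp (-θ (x + y * Complex.I))‖ ≤ Real.exp (3 * π) := by
  have h1 := norm_sub_le_verticalBound hθ hk hx hy
  have h2 := (abs_le.1 ((Complex.abs_re_le_norm _).trans h1)).1
  rw [hreal, Complex.sub_re, Complex.ofReal_re] at h2
  have h3 := etaF_nonneg (Real.exp_pos x).le
  have := mul_le_mul_of_nonneg_right hb Real.pi_pos.le
  rw [Complex.norm_exp, Real.exp_le_exp, Complex.neg_re]
  linarith

/-- The function `x ↦ f(e^x) / (e^c + e^x)` and its integral over the line. -/
theorem integrable_and_integral_fexit_exp_div (c : ℝ) :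
    Integrable (fun x : ℝ => fexit (Real.exp x) / (Real.exp c + Real.exp x)) ∧
    ∫ x : ℝ, fexit (Real.exp x) / (Real.exp c + Real.exp x)
      = (1 - Real.exp (-etaF (Real.exp c))) / Real.exp c := by
  have hpi := Real.pi_pos
  have hmemπ : π ∈ Icc 0 π := right_mem_Icc.2 hpi.le
  obtain ⟨θ, k, hθ, hk, hreal⟩ := exists_holomorphic_etaF_exp
  set Φ : ℂ → ℂ := fun w => Complex.exp (-θ w) with hΦ
  have hΦd : DifferentiableOn ℂ Φ logStrip := fun w hw =>
    ((hθ w hw).neg.cexp).differentiableAt.differentiableWithinAt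
  set v : ℝ := Real.exp (-etaF (Real.exp c)) with hv
  have hΦreal : ∀ x : ℝ, Φ x = (Real.exp (-etaF (Real.exp x)) : ℝ) := by
    intro x
    simp only [hΦ, hreal]
    push_cast
    rfl
  obtain ⟨Q, hQd, hQ⟩ := exists_differentiableOn_quotient isOpen_logStrip
    (N := fun w => Φ w - v) (D := fun w => Complex.exp w - Complex.exp c) (a := c)
    (ofReal_mem_logStrip c) (hΦd.sub_const _) (by fun_prop) (by simp [hΦreal, hv]) (by simp)
    (by
      have : HasDerivAt (fun w => Complex.exp w - Complex.exp c) (Complex.exp c) (c : ℂ) :=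
        (Complex.hasDerivAt_exp _).sub_const _
      rw [this.deriv]
      exact Complex.exp_ne_zero _)
    (fun z hz h => eq_of_exp_eq_exp_ofReal hz (sub_eq_zero.1 h))
  have hexpT := Real.exp_pos c
  -- Bounds and limits at the two vertical ends.
  have hQle : ∀ x y : ℝ, y ∈ Icc 0 π → ‖Q (x + y * Complex.I)‖ * |Real.exp x - Real.exp c| ≤
      ‖Φ (x + y * Complex.I)‖ + v := by
    intro x y hy
    have h1 := congrArg norm (hQ _ (mem_logStrip (x := x) hy))
    rw [norm_mul] at h1
    have h2 : |Real.exp x - Real.exp c| ≤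
        ‖Complex.exp (x + y * Complex.I) - Complex.exp c‖ := by
      have := abs_norm_sub_norm_le (Complex.exp (x + y * Complex.I)) (Complex.exp c)
      simpa [Complex.norm_exp] using this
    calc _ ≤ ‖Q (x + y * Complex.I)‖ * ‖Complex.exp (x + y * Complex.I) - Complex.exp c‖ := by
          gcongr
      _ = ‖Φ (x + y * Complex.I) - v‖ := h1
      _ ≤ ‖Φ (x + y * Complex.I)‖ + ‖(v : ℂ)‖ := norm_sub_le _ _
      _ = _ := by rw [Complex.norm_real, Real.norm_of_nonneg (Real.exp_pos _).le]
  have hM : ∀ x y : ℝ, 1 ≤ |x| → verticalBound x ≤ 3 → y ∈ Icc 0 π →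
      ‖Q (x + y * Complex.I)‖ * |Real.exp x - Real.exp c| ≤ Real.exp (3 * π) + v :=
    fun x y hx hb hy => (hQle x y hy).trans
      (add_le_add_left (norm_exp_neg_extension_le hθ hk hreal hx hy hb) _)
  have htop : Filter.Tendsto (fun x : ℝ => ∫ y in (0 : ℝ)..π, Q (x + y * Complex.I))
      Filter.atTop (nhds (π * 0)) := by
    have hle : ∀ᶠ x : ℝ in Filter.atTop, ∀ y ∈ Icc 0 π,
        ‖Q (x + y * Complex.I)‖ ≤ (Real.exp (3 * π) + v) / (Real.exp x - Real.exp c) := by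
      filter_upwards [Filter.eventually_ge_atTop (1 : ℝ), Filter.eventually_gt_atTop c]
        with x hx1 hxc y hy
      have h1 : 0 < Real.exp x - Real.exp c := sub_pos.2 (Real.exp_lt_exp.2 hxc)
      have := hM x y (hx1.trans (le_abs_self x)) (verticalBound_le (by linarith)) hy
      rwa [abs_of_pos h1, ← le_div_iff₀ h1] at this
    have hlim : Filter.Tendsto (fun x : ℝ => (Real.exp (3 * π) + v) / (Real.exp x - Real.exp c))
        Filter.atTop (nhds 0) :=
      Filter.Tendsto.const_div_atTop
        (Filter.tendsto_atTop_add_const_right _ _ Real.tendsto_exp_atTop) _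
    refine tendsto_integral_vertical hQd.continuousOn (M := 1) ?_ ?_
    · filter_upwards [hle, hlim.eventually_le_const one_pos] with x h1 h2 y hy
      exact (h1 y hy).trans h2
    · intro y hy
      refine squeeze_zero_norm' ?_ hlim
      filter_upwards [hle] with x h1
      exact h1 y hy
  have hbot : Filter.Tendsto (fun x : ℝ => ∫ y in (0 : ℝ)..π, Q (x + y * Complex.I))
      Filter.atBot (nhds (π * ((1 - v) / (0 - Complex.exp c)))) := by
    have hexp0 := Real.tendsto_exp_atBot
    refine tendsto_integral_vertical hQd.continuousOn
      (M := (Real.exp (3 * π) + v) / (Real.exp c / 2)) ?_ ?_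
    · filter_upwards [Filter.eventually_le_atBot (-1 : ℝ),
        tendsto_verticalBound_atBot.eventually_le_const (by norm_num : (0 : ℝ) < 3),
        hexp0.eventually_le_const (half_pos hexpT)] with x hx1 hx2 hx3 y hy
      have := hM x y (by rw [abs_of_nonpos] <;> linarith) hx2 hy
      rw [le_div_iff₀ (half_pos hexpT)]
      refine le_trans (mul_le_mul_of_nonneg_left ?_ (norm_nonneg _)) this
      rw [abs_sub_comm]
      exact (by linarith : Real.exp c / 2 ≤ Real.exp c - Real.exp x).trans (le_abs_self _)
    · intro y hy
      have a1 : Filter.Tendsto (fun x : ℝ => θ (x + y * Complex.I)) Filter.atBot (nhds 0) := by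
        have b1 : Filter.Tendsto (fun x : ℝ => θ (x + y * Complex.I) - θ x) Filter.atBot
            (nhds 0) := by
          refine squeeze_zero_norm' ?_ (by simpa using tendsto_verticalBound_atBot.mul_const π)
          filter_upwards [Filter.eventually_le_atBot (-1 : ℝ)] with x hx
          exact norm_sub_le_verticalBound hθ hk (by rw [abs_of_nonpos] <;> linarith) hy
        have b2 : Filter.Tendsto (fun x : ℝ => θ x) Filter.atBot (nhds 0) := by
          have := (Complex.continuous_ofReal.comp continuous_etaF).tendsto 0
          simpa [Function.comp_def, etaF_zero, hreal] using this.comp hexp0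
        simpa using b1.add b2
      have a2 : Filter.Tendsto (fun x : ℝ => Φ (x + y * Complex.I)) Filter.atBot (nhds 1) := by
        have := (Complex.continuous_exp.tendsto _).comp a1.neg
        simpa [Function.comp_def, hΦ] using this
      have a3 : Filter.Tendsto (fun x : ℝ => Complex.exp (x + y * Complex.I)) Filter.atBot
          (nhds 0) := by
        rw [tendsto_zero_iff_norm_tendsto_zero]
        simpa [Complex.norm_exp] using hexp0
      have hne : (0 : ℂ) - Complex.exp c ≠ 0 := by simp
      refine ((a2.sub_const (v : ℂ)).div (a3.sub_const (Complex.exp c)) hne).congr' ?_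
      filter_upwards [(a3.sub_const (Complex.exp c)).eventually_ne hne] with x hx
      rw [Pi.div_apply, div_eq_iff hx, hQ _ (mem_logStrip hy)]
  -- Boundary values on the two horizontal sides.
  have hQreal : ∀ x : ℝ, x ≠ c → (Q x).im = 0 := by
    intro x hx
    have h1 := hQ x (ofReal_mem_logStrip x)
    simp only [hΦreal] at h1
    have hne : Complex.exp x - Complex.exp c ≠ 0 := by
      have : Real.exp x - Real.exp c ≠ 0 := sub_ne_zero.2 fun h => hx (Real.exp_injective h)
      exact_mod_cast this
    rw [← eq_div_iff hne] at h1
    rw [h1, ← Complex.ofReal_sub, ← Complex.ofReal_exp, ← Complex.ofReal_exp,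
      ← Complex.ofReal_sub, ← Complex.ofReal_div, Complex.ofReal_im]
  have hQtop : ∀ x : ℝ, (Q (x + π * Complex.I)).im
      = π * (fexit (Real.exp x) / (Real.exp c + Real.exp x)) := by
    intro x
    have h1 := hQ _ (mem_logStrip (x := x) hmemπ)
    have h2 : Complex.exp (x + π * Complex.I) - Complex.exp c
        = ((-(Real.exp c + Real.exp x) : ℝ) : ℂ) := by
      rw [Complex.exp_add, Complex.exp_pi_mul_I]; push_cast; ring
    rw [h2] at h1
    have h3 := congrArg Complex.im h1
    rw [Complex.im_mul_ofReal, Complex.sub_im, Complex.ofReal_im, sub_zero,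
      im_exp_neg_extension_top hθ hk hreal] at h3
    field_simp
    linarith
  set φ : ℝ → ℝ := fun x => fexit (Real.exp x) / (Real.exp c + Real.exp x) with hφ
  have hφnonneg : ∀ x, 0 ≤ φ x := by
    intro x
    simp only [hφ, fexit]
    positivity
  have hφcont : Continuous φ :=
    (continuous_fexit.comp Real.continuous_exp).div (by fun_prop) fun x => by positivity
  have hrect : ∀ R : ℝ, π * ∫ x in (-R)..R, φ x =
      (∫ y in (0 : ℝ)..π, Q (R + y * Complex.I)).re
        - (∫ y in (0 : ℝ)..π, Q ((-R : ℝ) + y * Complex.I)).re := by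
    intro R
    have hd : DifferentiableOn ℂ Q
        (uIcc (-R : ℂ).re (R + π * Complex.I : ℂ).re ×ℂ
          uIcc (-R : ℂ).im (R + π * Complex.I : ℂ).im) := by
      refine hQd.mono fun w hw => ?_
      have := hw.2
      simp only [mem_preimage, Complex.neg_im, Complex.ofReal_im, neg_zero, Complex.add_im,
        Complex.mul_im, Complex.ofReal_re, Complex.I_im, mul_one, Complex.I_re, mul_zero,
        add_zero, zero_add, uIcc_of_le hpi.le] at this
      have h := mem_logStrip (x := w.re) this
      rwa [Complex.re_add_im] at h
    have h := congrArg Complex.im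
      (Complex.integral_boundary_rect_eq_zero_of_differentiableOn Q (-R) (R + π * Complex.I) hd)
    simp only [Complex.neg_im, Complex.neg_re, Complex.ofReal_im, Complex.ofReal_re, neg_zero,
      Complex.add_im, Complex.add_re, Complex.mul_im, Complex.mul_re, Complex.I_im, Complex.I_re,
      mul_one, mul_zero, add_zero, zero_add, sub_zero, Complex.ofReal_zero, zero_mul,
      Complex.sub_im, smul_eq_mul, one_mul, Complex.zero_im] at h
    have hi1 : IntervalIntegrable (fun x : ℝ => Q x) volume (-R) R :=
      (hQd.continuousOn.comp_continuous (by fun_prop) ofReal_mem_logStrip).intervalIntegrable _ _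
    have hi2 : IntervalIntegrable (fun x : ℝ => Q (x + π * Complex.I)) volume (-R) R :=
      (hQd.continuousOn.comp_continuous (by fun_prop)
        fun x => mem_logStrip hmemπ).intervalIntegrable _ _
    have e1 : (∫ x in (-R)..R, Q x).im = 0 := by
      have := Complex.imCLM.intervalIntegral_comp_comm hi1
      simp only [Complex.imCLM_apply] at this
      rw [← this]
      refine intervalIntegral.integral_zero_ae ?_
      filter_upwards [compl_mem_ae_iff.2 (measure_singleton c)] with x hx _
      exact hQreal x hx
    have e2 : (∫ x in (-R)..R, Q (x + π * Complex.I)).im = π * ∫ x in (-R)..R, φ x := by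
      have := Complex.imCLM.intervalIntegral_comp_comm hi2
      simp only [Complex.imCLM_apply, hQtop] at this
      rw [← this, intervalIntegral.integral_const_mul]
    rw [e1, e2] at h
    linarith
  have hlim : Filter.Tendsto (fun R : ℝ => ∫ x in (-R)..R, φ x) Filter.atTop
      (nhds ((1 - v) / Real.exp c)) := by
    have h1 := (Complex.continuous_re.tendsto _).comp htop
    have h2 := (Complex.continuous_re.tendsto _).comp (hbot.comp Filter.tendsto_neg_atTop_atBot)
    have h3 := (h1.sub h2).const_mul (1 / π)
    have hval : 1 / π * ((π * 0 : ℂ).re - (π * ((1 - v) / (0 - Complex.exp c)) : ℂ).re)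
        = (1 - v) / Real.exp c := by
      have : (π * ((1 - v) / (0 - Complex.exp c)) : ℂ)
          = ((π * ((1 - v) / (0 - Real.exp c)) : ℝ) : ℂ) := by push_cast; rfl
      rw [this, Complex.ofReal_re]
      simp
      field_simp
    rw [hval] at h3
    refine h3.congr fun R => ?_
    simp only [Function.comp]
    rw [← hrect R]
    field_simp
  have hint : Integrable φ := by
    refine integrable_of_intervalIntegral_norm_tendsto (l := Filter.atTop) ((1 - v) / Real.exp c)
      (fun R => (hφcont.integrableOn_Ioc)) Filter.tendsto_neg_atTop_atBot Filter.tendsto_id ?_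
    simpa [Real.norm_of_nonneg (hφnonneg _)] using hlim
  exact ⟨hint, tendsto_nhds_unique (intervalIntegral_tendsto_integral hint
    Filter.tendsto_neg_atTop_atBot Filter.tendsto_id) hlim⟩

theorem image_mul_exp_neg_univ {b : ℝ} (hb : 0 < b) :
    (fun x : ℝ => b * Real.exp (-x)) '' univ = Ioi 0 := by
  ext y
  constructor
  · rintro ⟨x, -, rfl⟩
    exact mul_pos hb (Real.exp_pos _)
  · intro hy
    refine ⟨-Real.log (y / b), trivial, ?_⟩
    simp only [neg_neg]
    rw [Real.exp_log (div_pos hy hb)]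
    field_simp

/-- The integral over the end point of the kernel in the definition of `pD`. -/
theorem integrableOn_and_integral_fexit_div {a b : ℝ} (ha : 0 < a) (hb : 0 < b) :
    IntegrableOn (fun y => 1 / y * (fexit (b / y) / (a + b / y))) (Ioi 0) ∧
    ∫ y in Ioi 0, 1 / y * (fexit (b / y) / (a + b / y)) = (1 - Real.exp (-etaF a)) / a := by
  have hder : ∀ x ∈ (univ : Set ℝ), HasDerivWithinAt (fun x : ℝ => b * Real.exp (-x))
      (-(b * Real.exp (-x))) univ x := by
    intro x _
    refine HasDerivAt.hasDerivWithinAt ?_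
    refine ((hasDerivAt_neg x).exp.const_mul b).congr_deriv ?_
    ring
  have hinj : InjOn (fun x : ℝ => b * Real.exp (-x)) univ := by
    intro x _ y _ h
    exact neg_injective (Real.exp_injective (mul_left_cancel₀ hb.ne' h))
  have heq : ∀ x : ℝ, |-(b * Real.exp (-x))| • (1 / (b * Real.exp (-x)) *
      (fexit (b / (b * Real.exp (-x))) / (a + b / (b * Real.exp (-x)))))
      = fexit (Real.exp x) / (Real.exp (Real.log a) + Real.exp x) := by
    intro x
    have h1 : b / (b * Real.exp (-x)) = Real.exp x := by
      rw [Real.exp_neg]; field_simp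
    have h2 : 0 < b * Real.exp (-x) := by positivity
    rw [h1, abs_neg, abs_of_pos h2, smul_eq_mul, ← mul_assoc, mul_one_div_cancel h2.ne', one_mul,
      Real.exp_log ha]
  have h := integrable_and_integral_fexit_exp_div (Real.log a)
  constructor
  · rw [← image_mul_exp_neg_univ hb,
      integrableOn_image_iff_integrableOn_abs_deriv_smul MeasurableSet.univ hder hinj]
    simp only [heq, integrableOn_univ]
    exact h.1
  · rw [← image_mul_exp_neg_univ hb,
      integral_image_eq_integral_abs_deriv_smul MeasurableSet.univ hder hinj]
    simp only [heq, Measure.restrict_univ]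
    rw [h.2, Real.exp_log ha]

theorem integrableOn_and_integral_cauchy_kernel {t x : ℝ} (ht : 0 < t) (hx : 0 < x) :
    IntegrableOn (fun y => (1 / π) * (t / (t ^ 2 + (x - y) ^ 2))) (Ioi 0) ∧
    ∫ y in Ioi 0, (1 / π) * (t / (t ^ 2 + (x - y) ^ 2)) = 1 - Real.arctan (t / x) / π := by
  have hder : ∀ y ∈ Ici (0 : ℝ), HasDerivAt (fun y => Real.arctan ((y - x) / t) / π)
      ((1 / π) * (t / (t ^ 2 + (x - y) ^ 2))) y := by
    intro y _
    refine ((((hasDerivAt_id y).sub_const x).div_const t).arctan.div_const π).congr_deriv ?_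
    have : 1 + ((y - x) / t) ^ 2 = (t ^ 2 + (x - y) ^ 2) / t ^ 2 := by field_simp; ring
    simp only [id]
    rw [this]
    field_simp
  have hpos : ∀ y ∈ Ioi (0 : ℝ), 0 ≤ (1 / π) * (t / (t ^ 2 + (x - y) ^ 2)) := by
    intro y _
    positivity
  have hlim : Filter.Tendsto (fun y => Real.arctan ((y - x) / t) / π) Filter.atTop
      (nhds (π / 2 / π)) := by
    refine Filter.Tendsto.div_const ?_ _
    refine (Filter.Tendsto.mono_right Real.tendsto_arctan_atTop nhdsWithin_le_nhds).comp ?_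
    exact (Filter.tendsto_atTop_add_const_right _ (-x) Filter.tendsto_id).atTop_div_const ht
  refine ⟨integrableOn_Ioi_deriv_of_nonneg' hder hpos hlim, ?_⟩
  rw [integral_Ioi_of_hasDerivAt_of_nonneg' hder hpos hlim, zero_sub, neg_div, Real.arctan_neg]
  have := Real.arctan_inv_of_pos (div_pos ht hx)
  rw [inv_div] at this
  rw [this]
  field_simp
  ring

theorem integral_inv_one_add_sq_scaled {t x : ℝ} (hx : 0 < x) :
    ∫ s in (0 : ℝ)..t, (1 / π) * (x / (x ^ 2 + s ^ 2)) = Real.arctan (t / x) / π := by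
  have hder : ∀ s ∈ uIcc 0 t, HasDerivAt (fun s => Real.arctan (s / x) / π)
      ((1 / π) * (x / (x ^ 2 + s ^ 2))) s := by
    intro s _
    refine (((hasDerivAt_id s).div_const x).arctan.div_const π).congr_deriv ?_
    have h1 : 1 + (s / x) ^ 2 = (x ^ 2 + s ^ 2) / x ^ 2 := by field_simp
    simp only [id]
    rw [h1]
    field_simp
  rw [intervalIntegral.integral_eq_sub_of_hasDerivAt hder]
  · simp
  · refine Continuous.intervalIntegrable ?_ _ _
    exact (continuous_const.div (by fun_prop) fun s => by positivity).const_mul _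

theorem fexit_div_eq {s x : ℝ} (hs : s ≠ 0) (hx : x ≠ 0) :
    fexit (s / x) / s = (1 / π) * (x / (x ^ 2 + s ^ 2)) * Real.exp (etaF (s / x)) := by
  have h1 : 1 + (s / x) ^ 2 = (x ^ 2 + s ^ 2) / x ^ 2 := by field_simp
  rw [fexit, h1]
  field_simp

theorem survival_probability_half_line (t x : ℝ) (ht : 0 < t) (hx : 0 < x) :
    (∫ y in Ioi (0 : ℝ), pD t x y) = 1 - ∫ s in (0 : ℝ)..t, fexit (s / x) / s := by
  set J : ℝ → ℝ → ℝ := fun y s =>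
    1 / (x * y) * (fexit (s / x) * fexit ((t - s) / y) / (s / x + (t - s) / y)) with hJ
  set h₁ : ℝ → ℝ := fun s => (1 / π) * (x / (x ^ 2 + s ^ 2)) * Real.exp (etaF (s / x)) with hh₁
  set h₂ : ℝ → ℝ := fun s => (1 / π) * (x / (x ^ 2 + s ^ 2)) with hh₂
  have hc₂ : Continuous h₂ :=
    (continuous_const.div (by fun_prop) fun s => by positivity).const_mul _
  have hc₁ : Continuous h₁ :=
    hc₂.mul (Real.continuous_exp.comp (continuous_etaF.comp (continuous_id.div_const x)))
  have hJeq : ∀ s y, J y s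
      = fexit (s / x) / x * (1 / y * (fexit ((t - s) / y) / (s / x + (t - s) / y))) := by
    intro s y
    simp only [hJ]
    ring
  have hinner : ∀ s ∈ Ioo 0 t, IntegrableOn (fun y => J y s) (Ioi 0) ∧
      ∫ y in Ioi 0, J y s = h₁ s - h₂ s := by
    intro s hs
    have hsx : 0 < s / x := div_pos hs.1 hx
    obtain ⟨hi, hv⟩ := integrableOn_and_integral_fexit_div hsx (sub_pos.2 hs.2)
    simp only [hJeq]
    refine ⟨hi.const_mul _, ?_⟩
    rw [integral_const_mul, hv]
    have hE : Real.exp (etaF (s / x)) * Real.exp (-etaF (s / x)) = 1 := by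
      rw [← Real.exp_add]; simp
    have h0 := fexit_div_eq hs.1.ne' hx.ne'
    calc _ = fexit (s / x) / s * (1 - Real.exp (-etaF (s / x))) := by field_simp
      _ = h₁ s - h₂ s := by
        rw [h0]
        simp only [hh₁, hh₂]
        linear_combination -(1 / π * (x / (x ^ 2 + s ^ 2))) * hE
  have hJnonneg : ∀ s ∈ Ioo 0 t, ∀ y ∈ Ioi (0 : ℝ), 0 ≤ J y s := by
    intro s hs y hy
    have h1 : 0 ≤ t - s := sub_nonneg.2 hs.2.le
    have hy' : 0 < y := hy
    have h2 := fexit_nonneg (div_nonneg hs.1.le hx.le)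
    have h3 := fexit_nonneg (div_nonneg h1 hy'.le)
    have h4 := hs.1
    simp only [hJ]
    positivity
  have hmeas : Measurable fun p : ℝ × ℝ => J p.2 p.1 := by
    have hf := continuous_fexit.measurable
    simp only [hJ]
    fun_prop
  have hJint : Integrable (fun p : ℝ × ℝ => J p.2 p.1)
      ((volume.restrict (Ioo 0 t)).prod (volume.restrict (Ioi 0))) := by
    rw [integrable_prod_iff hmeas.aestronglyMeasurable]
    constructor
    · filter_upwards [ae_restrict_mem measurableSet_Ioo] with s hs
      exact (hinner s hs).1
    · have : IntegrableOn (fun s => h₁ s - h₂ s) (Ioo 0 t) :=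
        ((hc₁.sub hc₂).integrableOn_Icc).mono_set Ioo_subset_Icc_self
      refine this.congr ?_
      filter_upwards [ae_restrict_mem measurableSet_Ioo] with s hs
      rw [← (hinner s hs).2]
      exact setIntegral_congr_fun measurableSet_Ioi fun y hy =>
        (Real.norm_of_nonneg (hJnonneg s hs y hy)).symm
  have hpD : ∀ y, pD t x y
      = (1 / π) * (t / (t ^ 2 + (x - y) ^ 2)) - ∫ s in Ioo 0 t, J y s := by
    intro y
    rw [pD, intervalIntegral.integral_of_le ht.le, integral_Ioc_eq_integral_Ioo,
      ← integral_const_mul]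
  have hswap : ∫ y in Ioi 0, ∫ s in Ioo 0 t, J y s = ∫ s in Ioo 0 t, (h₁ s - h₂ s) := by
    rw [← integral_integral_swap (f := fun s y => J y s) hJint]
    exact setIntegral_congr_fun measurableSet_Ioo fun s hs => (hinner s hs).2
  obtain ⟨hci, hcv⟩ := integrableOn_and_integral_cauchy_kernel ht hx
  simp only [hpD]
  rw [integral_sub hci hJint.integral_prod_right, hcv, hswap, ← integral_Ioc_eq_integral_Ioo,
    ← intervalIntegral.integral_of_le ht.le, intervalIntegral.integral_sub
      (hc₁.intervalIntegrable _ _) (hc₂.intervalIntegrable _ _),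
    integral_inv_one_add_sq_scaled hx]
  have : ∫ s in (0 : ℝ)..t, fexit (s / x) / s = ∫ s in (0 : ℝ)..t, h₁ s := by
    refine intervalIntegral.integral_congr_ae (Filter.Eventually.of_forall fun s hs => ?_)
    rw [uIoc_of_le ht.le] at hs
    exact fexit_div_eq hs.1.ne' hx.ne'
  rw [this]
  ring
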